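/- arXiv:2111.04351 — 2 statements merged into one kernel-verified Lean document; each statement's English description precedes it below -/
import Mathlib

section
/- Let ρ and σ_0,…,σ_{n−1} be positive-semidefinite d×d complex matrices such that tr(σ_y) = 1 for every y < n and σ_y·σ_{y'} = 0 whenever y ≠ y'. Let p_0,…,p_{n−1} ≥ 0 be real numbers such that ρ − p_y·σ_y is positive semidefinite for every y < n. Then Σ_{y<n} p_y ≤ tr(ρ). In particular, if tr(ρ) = 1 then Σ_{y<n} p_y ≤ 1. -/
open Matrix
open scoped ComplexOrder

/-- A Hermitian matrix `A` has a Hermitian generalized inverse `B` commuting with it, so that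
`A * B` is the orthogonal projection onto the range of `A`. -/
theorem Matrix.IsHermitian.exists_commute_mul_mul_eq_self {m : Type*} [Fintype m] [DecidableEq m]
    {A : Matrix m m ℂ} (hA : A.IsHermitian) :
    ∃ B : Matrix m m ℂ, B.IsHermitian ∧ A * B = B * A ∧ A * B * A = A := by
  have hs := hA.spectral_theorem
  set φ := Unitary.conjStarAlgAut ℂ (Matrix m m ℂ) hA.eigenvectorUnitary
  set v : m → ℂ := RCLike.ofReal ∘ hA.eigenvalues with hv
  refine ⟨φ (diagonal v⁻¹), ?_, ?_, ?_⟩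
  · rw [IsHermitian, ← star_eq_conjTranspose, ← map_star, star_eq_conjTranspose,
      diagonal_conjTranspose]
    congr 2
    ext i
    simp [hv]
  · rw [hs, ← map_mul, ← map_mul, diagonal_mul_diagonal, diagonal_mul_diagonal]
    simp only [mul_comm]
  · conv_lhs => rw [hs]
    conv_rhs => rw [hs]
    rw [← map_mul, ← map_mul, diagonal_mul_diagonal, diagonal_mul_diagonal]
    congr 2
    ext i
    exact mul_inv_mul_cancel (v i)

/-- Compressing to pairwise orthogonal projections does not increase the trace of a positive
semidefinite matrix. -/
theorem Matrix.PosSemidef.sum_trace_mul_projection_le {m ι : Type*} [Fintype m] [DecidableEq m]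
    [Fintype ι] {ρ : Matrix m m ℂ} (hρ : ρ.PosSemidef) {P : ι → Matrix m m ℂ}
    (hherm : ∀ i, (P i).IsHermitian) (hidem : ∀ i, P i * P i = P i)
    (horth : ∀ i j, i ≠ j → P i * P j = 0) :
    ∑ i, (ρ * P i).trace ≤ ρ.trace := by
  classical
  set S := ∑ i, P i with hS
  have hSherm : Sᴴ = S := by
    rw [hS, conjTranspose_sum]
    exact Finset.sum_congr rfl fun i _ => hherm i
  have hSidem : S * S = S := by
    rw [hS, Finset.sum_mul_sum]
    refine Finset.sum_congr rfl fun i _ => ?_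
    rw [Finset.sum_eq_single i (fun j _ hj => horth i j hj.symm) (by simp), hidem]
  have hnonneg := (hρ.mul_mul_conjTranspose_same (1 - S)).trace_nonneg
  have hcompl : (1 - S) * (1 - S) = 1 - S := by
    rw [mul_sub, sub_mul, sub_mul, hSidem]
    simp
  rw [conjTranspose_sub, conjTranspose_one, hSherm, trace_mul_cycle, hcompl, trace_mul_comm,
    mul_sub, mul_one, trace_sub, sub_nonneg] at hnonneg
  rwa [← trace_sum, ← Finset.mul_sum]

theorem stmt_5 (n d : ℕ) (ρ : Matrix (Fin d) (Fin d) ℂ)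
    (σ : Fin n → Matrix (Fin d) (Fin d) ℂ)
    (hρ : ρ.PosSemidef) (hσ : ∀ y, (σ y).PosSemidef)
    (htr : ∀ y, (σ y).trace = 1)
    (horth : ∀ y y', y ≠ y' → σ y * σ y' = 0)
    (p : Fin n → ℝ) (hp : ∀ y, 0 ≤ p y)
    (hdom : ∀ y, (ρ - (p y : ℂ) • σ y).PosSemidef) :
    (∑ y, p y) ≤ ρ.trace.re ∧ (ρ.trace = 1 → (∑ y, p y) ≤ 1) := by
  choose B hB hcomm hmul using fun y => (hσ y).isHermitian.exists_commute_mul_mul_eq_self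
  have hherm (y) : (σ y * B y).IsHermitian := by
    rw [IsHermitian, conjTranspose_mul, hB y, (hσ y).isHermitian, hcomm]
  have hidem (y) : σ y * B y * (σ y * B y) = σ y * B y := by
    rw [← mul_assoc, hmul]
  have horthP (y y') (h : y ≠ y') : σ y * B y * (σ y' * B y') = 0 := by
    rw [hcomm y, mul_assoc, ← mul_assoc (σ y), horth y y' h, zero_mul, mul_zero]
  have hle (y) : (p y : ℂ) ≤ (ρ * (σ y * B y)).trace := by
    have h := ((hdom y).mul_mul_conjTranspose_same (σ y * B y)).trace_nonneg
    rwa [hherm y, trace_mul_cycle, hidem, trace_mul_comm, sub_mul, trace_sub, smul_mul_assoc,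
      trace_smul, trace_mul_comm (σ y), hmul, htr, smul_eq_mul, mul_one, sub_nonneg] at h
  have hsum : ((∑ y, p y : ℝ) : ℂ) ≤ ρ.trace := by
    push_cast
    exact (Finset.sum_le_sum fun y _ => hle y).trans
      (hρ.sum_trace_mul_projection_le hherm hidem horthP)
  have hre : ∑ y, p y ≤ ρ.trace.re := by
    simpa only [Complex.ofReal_re] using (Complex.le_def.mp hsum).1
  exact ⟨hre, fun h => by simpa only [h, Complex.one_re] using hre⟩
end

section
/- Let n ≥ 2, let ψ_0,…,ψ_{n−1} be unit vectors spanning a finite-dimensional complex inner product space H with dim H ≥ 2, let T = Σ_{i<n} ψ_iψ_i* be their frame operator with smallest eigenvalue λ_min(T), and suppose λ_min(T) < n. Then for every η with 0 < η ≤ 1/(n − λ_min(T)), there exist positive-semidefinite operators M_0,…,M_n on H with Σ_{i=0}^{n} M_i = 𝟙 such that M_i = η·(𝟙 − ψ_iψ_i*) for all i < n; consequently, for all x, y < n, ⟨ψ_x, M_y ψ_x⟩ = η·(1 − |⟨ψ_y, ψ_x⟩|²). -/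
open scoped InnerProductSpace

/-- The rank-one operator `ψψ* : x ↦ ⟪ψ, x⟫ • ψ`. -/
noncomputable def outer {H : Type*} [NormedAddCommGroup H] [InnerProductSpace ℂ H]
    (ψ : H) : H →ₗ[ℂ] H :=
  (innerₛₗ ℂ ψ).smulRight ψ

/-- Positive semidefiniteness of an operator on a complex inner product space. -/
def IsPosSemidef {H : Type*} [NormedAddCommGroup H] [InnerProductSpace ℂ H]
    (A : H →ₗ[ℂ] H) : Prop :=
  A.IsSymmetric ∧ ∀ x : H, 0 ≤ (⟪x, A x⟫_ℂ).re

theorem inner_outer_apply {H : Type*} [NormedAddCommGroup H] [InnerProductSpace ℂ H]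
    (ψ x : H) : ⟪x, outer ψ x⟫_ℂ = ((‖⟪ψ, x⟫_ℂ‖ ^ 2 : ℝ) : ℂ) := by
  simp only [outer, LinearMap.smulRight_apply, innerₛₗ_apply_apply, inner_smul_right]
  rw [← inner_conj_symm x ψ, Complex.mul_conj, Complex.normSq_eq_norm_sq]

theorem isSymmetric_outer {H : Type*} [NormedAddCommGroup H] [InnerProductSpace ℂ H]
    (ψ : H) : (outer ψ).IsSymmetric := by
  intro x y
  simp only [outer, LinearMap.smulRight_apply, innerₛₗ_apply_apply, inner_smul_right,
    inner_smul_left, inner_conj_symm]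
  ring

theorem LinearMap.IsSymmetric.real_smul {H : Type*} [NormedAddCommGroup H]
    [InnerProductSpace ℂ H] {A : H →ₗ[ℂ] H} (hA : A.IsSymmetric) (c : ℝ) :
    ((c : ℂ) • A).IsSymmetric :=
  hA.smul (Complex.conj_ofReal c)

/-- The Rayleigh bound: a lower bound on the eigenvalues of a symmetric operator bounds its
quadratic form from below. -/
theorem LinearMap.IsSymmetric.le_re_inner_of_le_eigenvalues {H : Type*} [NormedAddCommGroup H]
    [InnerProductSpace ℂ H] [FiniteDimensional ℂ H] {A : H →ₗ[ℂ] H} (hA : A.IsSymmetric)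
    {a : ℝ} (ha : ∀ c : ℝ, Module.End.HasEigenvalue A (c : ℂ) → a ≤ c) (x : H) :
    a * ‖x‖ ^ 2 ≤ (⟪x, A x⟫_ℂ).re := by
  set b := hA.eigenvectorBasis rfl
  have hterm (i) : (⟪x, b i⟫_ℂ * ⟪b i, A x⟫_ℂ).re
      = hA.eigenvalues rfl i * ‖⟪b i, x⟫_ℂ‖ ^ 2 := by
    have h : ⟪x, b i⟫_ℂ * ⟪b i, A x⟫_ℂ
        = ((hA.eigenvalues rfl i * ‖⟪b i, x⟫_ℂ‖ ^ 2 : ℝ) : ℂ) := by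
      rw [← hA (b i) x, hA.apply_eigenvectorBasis rfl i, inner_smul_left, ← inner_conj_symm x,
        mul_left_comm, mul_comm (starRingEnd ℂ _) ⟪b i, x⟫_ℂ, Complex.mul_conj,
        Complex.normSq_eq_norm_sq]
      simp
    rw [h, Complex.ofReal_re]
  rw [← b.sum_inner_mul_inner x (A x), Complex.re_sum, ← b.sum_sq_norm_inner_right x,
    Finset.mul_sum]
  refine Finset.sum_le_sum fun i _ => ?_
  rw [hterm i]
  exact mul_le_mul_of_nonneg_right (ha _ (hA.hasEigenvalue_eigenvalues rfl i)) (sq_nonneg _)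

theorem stmt_16 {H : Type*} [NormedAddCommGroup H] [InnerProductSpace ℂ H]
    [FiniteDimensional ℂ H] (hdim : 2 ≤ Module.finrank ℂ H)
    (n : ℕ) (hn : 2 ≤ n) (ψ : Fin n → H) (hψ : ∀ i, ‖ψ i‖ = 1)
    (hspan : Submodule.span ℂ (Set.range ψ) = ⊤)
    (T : H →ₗ[ℂ] H) (hT : T = ∑ i, outer (ψ i))
    (lammin : ℝ)
    (hEig : Module.End.HasEigenvalue T (lammin : ℂ))
    (hMin : ∀ c : ℝ, Module.End.HasEigenvalue T (c : ℂ) → lammin ≤ c)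
    (hlt : lammin < n)
    (η : ℝ) (hη0 : 0 < η) (hη1 : η ≤ 1 / (n - lammin)) :
    ∃ M : Fin (n + 1) → (H →ₗ[ℂ] H),
      (∀ i, IsPosSemidef (M i)) ∧
      (∑ i, M i) = 1 ∧
      (∀ i : Fin n, M i.castSucc = (η : ℂ) • ((1 : H →ₗ[ℂ] H) - outer (ψ i))) ∧
      (∀ x y : Fin n, ⟪ψ x, M y.castSucc (ψ x)⟫_ℂ
        = ((η * (1 - ‖⟪ψ y, ψ x⟫_ℂ‖ ^ 2) : ℝ) : ℂ)) := by
  have hTsymm : T.IsSymmetric := by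
    rw [hT]
    intro x y
    simp only [LinearMap.sum_apply, sum_inner, inner_sum]
    exact Finset.sum_congr rfl fun i _ => isSymmetric_outer (ψ i) x y
  have hinner (y : Fin n) (x : H) :
      ⟪x, ((η : ℂ) • ((1 : H →ₗ[ℂ] H) - outer (ψ y))) x⟫_ℂ
        = ((η * (‖x‖ ^ 2 - ‖⟪ψ y, x⟫_ℂ‖ ^ 2) : ℝ) : ℂ) := by
    rw [LinearMap.smul_apply, LinearMap.sub_apply, inner_smul_right, inner_sub_right,
      inner_outer_apply, Module.End.one_apply, inner_self_eq_norm_sq_to_K]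
    simp
  have hηn : η * (n - lammin) ≤ 1 := (le_div_iff₀ (sub_pos.2 hlt)).1 hη1
  refine ⟨Fin.snoc (fun i => (η : ℂ) • ((1 : H →ₗ[ℂ] H) - outer (ψ i)))
    (((1 - η * n : ℝ) : ℂ) • (1 : H →ₗ[ℂ] H) + (η : ℂ) • T), fun i => ?_, ?_, fun i => ?_,
    fun x y => ?_⟩
  · induction i using Fin.lastCases with
    | last =>
      rw [Fin.snoc_last]
      refine ⟨(LinearMap.IsSymmetric.one.real_smul _).add (hTsymm.real_smul _), fun x => ?_⟩
      have hx := hTsymm.le_re_inner_of_le_eigenvalues hMin x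
      have hself : (⟪x, x⟫_ℂ).re = ‖x‖ ^ 2 := inner_self_eq_norm_sq (𝕜 := ℂ) x
      rw [LinearMap.add_apply, LinearMap.smul_apply, LinearMap.smul_apply, inner_add_right,
        inner_smul_right, inner_smul_right, Complex.add_re, Complex.re_ofReal_mul,
        Complex.re_ofReal_mul, Module.End.one_apply, hself]
      nlinarith [mul_le_mul_of_nonneg_left hx hη0.le,
        mul_nonneg (sub_nonneg.2 hηn) (sq_nonneg ‖x‖)]
    | cast i =>
      rw [Fin.snoc_castSucc]
      refine ⟨(LinearMap.IsSymmetric.one.sub (isSymmetric_outer _)).real_smul _, fun x => ?_⟩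
      rw [hinner, Complex.ofReal_re]
      have h := norm_inner_le_norm (𝕜 := ℂ) (ψ i) x
      rw [hψ, one_mul] at h
      exact mul_nonneg hη0.le (sub_nonneg.2 (pow_le_pow_left₀ (norm_nonneg _) h 2))
  · simp only [Fin.sum_univ_castSucc, Fin.snoc_castSucc, Fin.snoc_last]
    rw [← Finset.smul_sum, Finset.sum_sub_distrib, ← hT, Finset.sum_const, Finset.card_univ,
      Fintype.card_fin, ← Nat.cast_smul_eq_nsmul ℂ]
    push_cast
    module
  · rw [Fin.snoc_castSucc]
  · rw [Fin.snoc_castSucc, hinner, hψ, one_pow]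
end
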